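/- There exists a subgroup M of B₄(S²) such that M is isomorphic to the direct product (QuaternionGroup 2) × Multiplicative ℤ (i.e. Q₈ × ℤ) and M is maximal as a virtually cyclic subgroup of B₄(S²): M is virtually cyclic and every virtually cyclic subgroup of B₄(S²) containing M equals M. -/

import Mathlib

/-- The defining relators of the sphere braid group `B₄(S²)` on generators
`σ₁ = of 0`, `σ₂ = of 1`, `σ₃ = of 2`:
`σ₁σ₃ = σ₃σ₁`, `σ₁σ₂σ₁ = σ₂σ₁σ₂`, `σ₂σ₃σ₂ = σ₃σ₂σ₃`, `σ₁σ₂σ₃²σ₂σ₁ = 1`. -/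
def sphereBraidRels : Set (FreeGroup (Fin 3)) :=
  { FreeGroup.of 0 * FreeGroup.of 2 * (FreeGroup.of 2 * FreeGroup.of 0)⁻¹,
    FreeGroup.of 0 * FreeGroup.of 1 * FreeGroup.of 0 *
      (FreeGroup.of 1 * FreeGroup.of 0 * FreeGroup.of 1)⁻¹,
    FreeGroup.of 1 * FreeGroup.of 2 * FreeGroup.of 1 *
      (FreeGroup.of 2 * FreeGroup.of 1 * FreeGroup.of 2)⁻¹,
    FreeGroup.of 0 * FreeGroup.of 1 * FreeGroup.of 2 ^ 2 * FreeGroup.of 1 * FreeGroup.of 0 }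

/-- The braid group `B₄(S²)` of the sphere on four strings, as a presented group. -/
abbrev B4S2 : Type := PresentedGroup sphereBraidRels

/-- The generator `σᵢ₊₁` of `B₄(S²)`. -/
def σ (i : Fin 3) : B4S2 := PresentedGroup.of i

/-- A group is *virtually cyclic* if it contains a cyclic subgroup of finite index. -/
def IsVirtuallyCyclic (G : Type*) [Group G] : Prop :=
  ∃ H : Subgroup G, IsCyclic H ∧ H.FiniteIndex

/-- A subgroup `H` of `G` is *maximal as a virtually cyclic subgroup* if `H` is virtually
cyclic and is not properly contained in any virtually cyclic subgroup of `G`. -/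
def IsMaximalVirtuallyCyclic {G : Type*} [Group G] (H : Subgroup G) : Prop :=
  IsVirtuallyCyclic H ∧ ∀ K : Subgroup G, IsVirtuallyCyclic K → H ≤ K → K = H

section BraidRelations

variable {G : Type*} [Group G] {a b c : G}

/-- Three elements of a group satisfying the defining relations of `B₄(S²)`. -/
structure SphereBraidRelations (a b c : G) : Prop where
  comm : a * c = c * a
  braid_left : a * b * a = b * a * b
  braid_right : b * c * b = c * b * c
  sphere : a * b * c ^ 2 * b * a = 1

theorem braid_mul_left (h : a * b * a = b * a * b) : a * b * a * a = b * (a * b * a) := by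
  nth_rw 1 [h]; simp only [mul_assoc]

theorem braid_mul_right (h : a * b * a = b * a * b) : a * b * a * b = a * (a * b * a) := by
  nth_rw 2 [h]; simp only [mul_assoc]

theorem braid_sq (h : a * b * a = b * a * b) :
    a * b * a * (a * b * a) = a * a * b * (a * a * b) := by
  calc a * b * a * (a * b * a) = a * b * a * b * (a * b) := by nth_rw 2 [h]; simp only [mul_assoc]
    _ = a * a * b * (a * a * b) := by rw [braid_mul_right h]; simp only [mul_assoc]

theorem braid_sq_comm_left (h : a * b * a = b * a * b) :
    Commute (a * b * a * (a * b * a)) a := by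
  rw [commute_iff_eq, mul_assoc (a * b * a), braid_mul_left h, ← mul_assoc (a * b * a),
    braid_mul_right h, mul_assoc]

theorem braid_sq_comm_right (h : a * b * a = b * a * b) :
    Commute (a * b * a * (a * b * a)) b := by
  rw [commute_iff_eq, mul_assoc (a * b * a), braid_mul_right h, ← mul_assoc (a * b * a),
    braid_mul_left h, mul_assoc]

theorem braid_sandwich (h : a * b * a = b * a * b) :
    a * (b * b) * a = a * b * a * (a * b * a) * (b⁻¹ * b⁻¹) := by
  calc a * (b * b) * a = a * b * (b * a * b) * b⁻¹ := by group
    _ = a * b * a * b * a * b⁻¹ := by rw [← h]; simp only [mul_assoc]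
    _ = a * b * a * (b * a * b) * (b⁻¹ * b⁻¹) := by group
    _ = _ := by rw [← h]

namespace SphereBraidRelations

theorem symm (h : SphereBraidRelations a b c) : SphereBraidRelations c b a where
  comm := h.comm.symm
  braid_left := h.braid_right.symm
  braid_right := h.braid_left.symm
  sphere := by
    have h1 : a * b * c * (c * b * a) = 1 := by rw [← h.sphere]; simp only [sq, mul_assoc]
    rw [mul_eq_one_comm] at h1
    rw [← h1]; simp only [sq, mul_assoc]

theorem mul_sq_mul (h : SphereBraidRelations a b c) : b * (c * c) * b = a⁻¹ * a⁻¹ := by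
  have h1 : a * (b * (c * c) * b) * a = 1 := by rw [← h.sphere]; simp only [sq, mul_assoc]
  calc b * (c * c) * b = a⁻¹ * (a * (b * (c * c) * b) * a) * a⁻¹ := by group
    _ = _ := by rw [h1, mul_one]

theorem ratio_sq (h : SphereBraidRelations a b c) :
    a * c⁻¹ * (a * c⁻¹) = a * b * a * (a * b * a) := by
  have hc : Commute c⁻¹ a := (Commute.inv_right h.comm).symm
  calc a * c⁻¹ * (a * c⁻¹) = a * (c⁻¹ * a) * c⁻¹ := by simp only [mul_assoc]
    _ = a * a * (c⁻¹ * c⁻¹) := by rw [hc.eq]; simp only [mul_assoc]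
    _ = _ := by rw [← h.symm.mul_sq_mul, braid_sq h.braid_left]; simp only [mul_assoc]

theorem ratio_sq_inv (h : SphereBraidRelations a b c) :
    (a * c⁻¹ * (a * c⁻¹))⁻¹ = c * b * c * (c * b * c) := by
  rw [← h.symm.ratio_sq, (show c * a⁻¹ = (a * c⁻¹)⁻¹ by group), mul_inv_rev]

theorem commute_ratio_sq_left (h : SphereBraidRelations a b c) :
    Commute (a * c⁻¹ * (a * c⁻¹)) a := by
  rw [h.ratio_sq]; exact braid_sq_comm_left h.braid_left

theorem commute_ratio_sq_mid (h : SphereBraidRelations a b c) :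
    Commute (a * c⁻¹ * (a * c⁻¹)) b := by
  rw [h.ratio_sq]; exact braid_sq_comm_right h.braid_left

theorem commute_ratio_sq_right (h : SphereBraidRelations a b c) :
    Commute (a * c⁻¹ * (a * c⁻¹)) c := by
  rw [← Commute.inv_left_iff, h.ratio_sq_inv]; exact braid_sq_comm_left h.symm.braid_left

theorem ratio_sq_eq_inv (h : SphereBraidRelations a b c) :
    (a * c⁻¹ * (a * c⁻¹))⁻¹ = a * c⁻¹ * (a * c⁻¹) := by
  have ha : a * b * c * a = b * (a * b * c) := by
    rw [mul_assoc, ← h.comm, ← mul_assoc, h.braid_left]; simp only [mul_assoc]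
  have hb : a * b * c * b = c * (a * b * c) := by
    calc a * b * c * b = a * (b * c * b) := by simp only [mul_assoc]
      _ = a * c * b * c := by rw [h.braid_right]; simp only [mul_assoc]
      _ = _ := by rw [h.comm]; simp only [mul_assoc]
  have hconj : SemiconjBy (a * b * c) (a * b * a * (a * b * a)) (b * c * b * (b * c * b)) := by
    have ha' : SemiconjBy (a * b * c) a b := ha
    have hb' : SemiconjBy (a * b * c) b c := hb
    have := (ha'.mul_right hb').mul_right ha'
    exact this.mul_right this
  have hcomm : Commute (a * b * a * (a * b * a)) (a * b * c) := by
    rw [← h.ratio_sq]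
    exact (h.commute_ratio_sq_left.mul_right h.commute_ratio_sq_mid).mul_right
      h.commute_ratio_sq_right
  have : b * c * b * (b * c * b) = a * b * a * (a * b * a) :=
    mul_right_cancel (hconj.eq.symm.trans hcomm.symm.eq)
  rw [h.ratio_sq_inv, h.ratio_sq, ← this, h.braid_right]

/-- Conjugation by `b` sends `b(ac⁻¹)b⁻¹` to `(ac⁻¹)⁻¹`. -/
theorem conj_mid (h : SphereBraidRelations a b c) :
    b * (b * (a * c⁻¹) * b⁻¹) * b⁻¹ = (a * c⁻¹)⁻¹ := by
  have key : a * (b * b) * a = c * (b * b) * c := by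
    rw [braid_sandwich h.braid_left, braid_sandwich h.symm.braid_left, ← h.ratio_sq,
      ← h.ratio_sq_inv, h.ratio_sq_eq_inv]
  have : b * b * (a * c⁻¹) = a⁻¹ * c * (b * b) := by
    calc b * b * (a * c⁻¹) = a⁻¹ * (a * (b * b) * a) * c⁻¹ := by group
      _ = _ := by rw [key]; group
  have hc : Commute a⁻¹ c := Commute.inv_left h.comm
  calc b * (b * (a * c⁻¹) * b⁻¹) * b⁻¹ = b * b * (a * c⁻¹) * (b⁻¹ * b⁻¹) := by
        simp only [mul_assoc]
    _ = a⁻¹ * c := by rw [this]; group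
    _ = _ := by rw [hc.eq]; group

/-- Conjugation by `a` sends `y = b(ac⁻¹)b⁻¹` to `(ac⁻¹)y`. -/
theorem conj_left (h : SphereBraidRelations a b c) :
    a * (b * (a * c⁻¹) * b⁻¹) * a⁻¹ = a * c⁻¹ * (b * (a * c⁻¹) * b⁻¹) := by
  have hc : Commute c⁻¹ a := (Commute.inv_right h.comm).symm
  have h1 : b⁻¹ * a⁻¹ * b = a * b⁻¹ * a⁻¹ := by
    calc b⁻¹ * a⁻¹ * b = a * (b * a * b)⁻¹ * b := by rw [← h.braid_left]; group
      _ = _ := by group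
  have h2 : c⁻¹ * b⁻¹ * c = b * c⁻¹ * b⁻¹ := by
    calc c⁻¹ * b⁻¹ * c = b * (c * b * c)⁻¹ * c := by rw [← h.braid_right]; group
      _ = _ := by group
  have h3 : b * (a * a) * b = c⁻¹ * c⁻¹ := h.symm.mul_sq_mul
  have h4 : b⁻¹ * (a⁻¹ * a⁻¹) * b⁻¹ = c * c := by
    rw [← inv_inj]; simpa [mul_assoc] using h3
  rw [← mul_inv_eq_iff_eq_mul]
  calc a * (b * (a * c⁻¹) * b⁻¹) * a⁻¹ * (b * (a * c⁻¹) * b⁻¹)⁻¹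
      = a * b * (a * c⁻¹) * (b⁻¹ * a⁻¹ * b) * (c * a⁻¹) * b⁻¹ := by group
    _ = a * b * a * (c⁻¹ * a) * b⁻¹ * (a⁻¹ * c) * a⁻¹ * b⁻¹ := by rw [h1]; group
    _ = a * b * (a * a) * (c⁻¹ * b⁻¹ * c) * (a⁻¹ * a⁻¹) * b⁻¹ := by
      rw [hc.eq, (show a⁻¹ * c = c * a⁻¹ from Commute.inv_left h.comm)]; group
    _ = a * (b * (a * a) * b) * c⁻¹ * (b⁻¹ * (a⁻¹ * a⁻¹) * b⁻¹) := by rw [h2]; group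
    _ = a * c⁻¹ := by rw [h3, h4]; group

/-- Conjugation by `c` sends `y = b(ac⁻¹)b⁻¹` to `y(ac⁻¹)`. -/
theorem conj_right (h : SphereBraidRelations a b c) :
    c * (b * (a * c⁻¹) * b⁻¹) * c⁻¹ = b * (a * c⁻¹) * b⁻¹ * (a * c⁻¹) := by
  rw [← inv_inj]
  have := h.symm.conj_left
  simpa [mul_assoc] using this

/-- The elements `x = ac⁻¹` and `y = b(ac⁻¹)b⁻¹` satisfy `xy = yx⁻¹`. -/
theorem ratio_mul_conj (h : SphereBraidRelations a b c) :
    a * c⁻¹ * (b * (a * c⁻¹) * b⁻¹) = b * (a * c⁻¹) * b⁻¹ * (a * c⁻¹)⁻¹ := by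
  have hx : a * (a * c⁻¹) * a⁻¹ = a * c⁻¹ := by
    rw [mul_assoc, mul_assoc a c⁻¹, (Commute.inv_inv h.comm.symm).eq]; group
  calc a * c⁻¹ * (b * (a * c⁻¹) * b⁻¹) = a * (b * (a * c⁻¹) * b⁻¹) * a⁻¹ := h.conj_left.symm
    _ = a * b * (a * (a * c⁻¹) * a⁻¹) * b⁻¹ * a⁻¹ := by rw [hx]; group
    _ = a * b * a * (a * c⁻¹) * (a * b * a)⁻¹ := by group
    _ = b * (a * (b * (a * c⁻¹) * b⁻¹) * a⁻¹) * b⁻¹ := by rw [h.braid_left]; group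
    _ = b * (a * c⁻¹) * b⁻¹ * (b * (b * (a * c⁻¹) * b⁻¹) * b⁻¹) := by rw [h.conj_left]; group
    _ = _ := by rw [h.conj_mid]

end SphereBraidRelations

end BraidRelations

section PowerHomomorphisms

variable {G : Type*} [Group G]

/-- The homomorphism from the cyclic group of order `n` sending the generator to `x`,
where `x ^ n = 1`. -/
def zmodPowersHom (n : ℕ) (x : G) (hx : x ^ n = 1) : Multiplicative (ZMod n) →* G :=
  AddMonoidHom.toMultiplicativeLeft
    (ZMod.lift n ⟨zmultiplesHom (Additive G) (Additive.ofMul x), by simp [← ofMul_pow, hx]⟩)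

theorem zmodPowersHom_intCast {n : ℕ} {x : G} (hx : x ^ n = 1) (k : ℤ) :
    zmodPowersHom n x hx (Multiplicative.ofAdd (k : ZMod n)) = x ^ k := by
  simp [zmodPowersHom]

theorem zmodPowersHom_apply {n : ℕ} [NeZero n] {x : G} (hx : x ^ n = 1)
    (k : Multiplicative (ZMod n)) : zmodPowersHom n x hx k = x ^ k.toAdd.val := by
  conv_lhs => rw [← ofAdd_toAdd k, ← ZMod.natCast_zmod_val k.toAdd, ← Int.cast_natCast,
    zmodPowersHom_intCast, zpow_natCast]

namespace QuaternionGroup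

/-- The homomorphism out of a dicyclic group determined by elements satisfying its defining
relations. -/
def lift {n : ℕ} (x y : G) (hx : x ^ (2 * n) = 1) (hy : y * y = x ^ n) (hxy : x * y = y * x⁻¹) :
    QuaternionGroup n →* G where
  toFun
    | a i => zmodPowersHom (2 * n) x hx (Multiplicative.ofAdd i)
    | xa i => y * zmodPowersHom (2 * n) x hx (Multiplicative.ofAdd i)
  map_one' := map_one (zmodPowersHom (2 * n) x hx)
  map_mul' := by
    have hyx (k : ℤ) : x ^ k * y = y * x ^ (-k) := by
      have : SemiconjBy y x⁻¹ x := hxy.symm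
      have := (this.zpow_right k).eq
      rw [zpow_neg, ← inv_zpow, this]
    rintro (i | i) (j | j) <;>
      obtain ⟨i, rfl⟩ := ZMod.intCast_surjective i <;>
      obtain ⟨j, rfl⟩ := ZMod.intCast_surjective j
    · simp only [a_mul_a, ← Int.cast_add, zmodPowersHom_intCast, zpow_add]
    · simp only [a_mul_xa, ← Int.cast_sub, zmodPowersHom_intCast]
      rw [← mul_assoc, hyx, mul_assoc, ← zpow_add, neg_add_eq_sub]
    · simp only [xa_mul_a, ← Int.cast_add, zmodPowersHom_intCast, zpow_add, mul_assoc]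
    · have : ((n : ZMod (2 * n)) + j - i) = ((n + j - i : ℤ) : ZMod (2 * n)) := by push_cast; rfl
      simp only [xa_mul_xa, this, zmodPowersHom_intCast]
      rw [mul_assoc, ← mul_assoc _ y, hyx, mul_assoc, ← mul_assoc y, hy, ← zpow_natCast,
        ← zpow_add, ← zpow_add]
      congr 1; ring

section

variable {n : ℕ} {x y : G} {hx : x ^ (2 * n) = 1} {hy : y * y = x ^ n} {hxy : x * y = y * x⁻¹}

@[simp]
theorem lift_a (k : ℤ) : lift x y hx hy hxy (a k) = x ^ k := zmodPowersHom_intCast hx k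

@[simp]
theorem lift_xa (k : ℤ) : lift x y hx hy hxy (xa k) = y * x ^ k :=
  congrArg (y * ·) (zmodPowersHom_intCast hx k)

theorem range_lift : (lift x y hx hy hxy).range = Subgroup.closure {x, y} := by
  apply le_antisymm
  · have mx : x ∈ Subgroup.closure {x, y} := Subgroup.subset_closure (by simp)
    have my : y ∈ Subgroup.closure {x, y} := Subgroup.subset_closure (by simp)
    rintro _ ⟨i | i, rfl⟩ <;> obtain ⟨k, rfl⟩ := ZMod.intCast_surjective i
    · rw [lift_a]; exact zpow_mem mx k
    · rw [lift_xa]; exact mul_mem my (zpow_mem mx k)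
  · rw [Subgroup.closure_le]
    rintro _ (rfl | rfl)
    · exact ⟨a (1 : ℤ), by rw [lift_a, zpow_one]⟩
    · exact ⟨xa (0 : ℤ), by rw [lift_xa, zpow_zero, mul_one]⟩

end

end QuaternionGroup

/-- In a virtually cyclic group, every element of infinite order has a nontrivial power which every
element conjugates to itself or to its inverse. -/
theorem IsVirtuallyCyclic.exists_conj_pow (hG : IsVirtuallyCyclic G) {g : G}
    (hg : ¬IsOfFinOrder g) (k : G) :
    ∃ n : ℕ, 0 < n ∧ (k * g ^ n * k⁻¹ = g ^ n ∨ k * g ^ n * k⁻¹ = (g ^ n)⁻¹) := by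
  obtain ⟨H, hH, hfin⟩ := hG
  have : IsCyclic H.normalCore :=
    isCyclic_of_injective (Subgroup.inclusion H.normalCore_le) (Subgroup.inclusion_injective _)
  obtain ⟨h, hh⟩ := (Subgroup.isCyclic_iff_exists_zpowers_eq_top H.normalCore).1 this
  obtain ⟨n, hn, -, hmem⟩ := Subgroup.exists_pow_mem_of_index_ne_zero
    (Subgroup.FiniteIndex.index_ne_zero (H := H.normalCore)) g
  rw [← hh] at hmem
  obtain ⟨j, hj⟩ := Subgroup.mem_zpowers_iff.1 hmem
  have hord : ¬IsOfFinOrder h := fun hf => hg <| by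
    have := hf.zpow (i := j)
    rw [hj] at this
    exact (isOfFinOrder_pow.1 this).resolve_right hn.ne'
  have hconj (k : G) : ∃ m : ℤ, k * h * k⁻¹ = h ^ m := by
    have : k * h * k⁻¹ ∈ H.normalCore :=
      Subgroup.normalCore_normal H |>.conj_mem h (hh ▸ Subgroup.mem_zpowers h) k
    rw [← hh] at this
    obtain ⟨m, hm⟩ := Subgroup.mem_zpowers_iff.1 this
    exact ⟨m, hm.symm⟩
  obtain ⟨m, hm⟩ := hconj k
  obtain ⟨l, hl⟩ := hconj k⁻¹
  have hml : h ^ (l * m) = h ^ (1 : ℤ) := by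
    rw [zpow_mul, ← hl, conj_zpow, ← hm]; group
  have hml' : l * m = 1 := injective_zpow_iff_not_isOfFinOrder.2 hord hml
  refine ⟨n, hn, ?_⟩
  rw [← hj, ← conj_zpow, hm]
  rcases Int.eq_one_or_neg_one_of_mul_eq_one' hml' with ⟨-, rfl⟩ | ⟨-, rfl⟩
  · left; simp
  · right; simp

/-- A group isomorphic to the product of a finite group and `ℤ` is virtually cyclic. -/
theorem isVirtuallyCyclic_of_mulEquiv_prod {F : Type*} [Group F] [Finite F]
    (e : G ≃* F × Multiplicative ℤ) : IsVirtuallyCyclic G := by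
  let f : G →* F := (MonoidHom.fst F (Multiplicative ℤ)).comp e.toMonoidHom
  let s : f.ker →* Multiplicative ℤ :=
    ((MonoidHom.snd F (Multiplicative ℤ)).comp e.toMonoidHom).comp f.ker.subtype
  refine ⟨f.ker, isCyclic_of_injective s ?_, inferInstance⟩
  rintro ⟨u, hu⟩ ⟨v, hv⟩ huv
  exact Subtype.ext (e.injective (Prod.ext (hu.trans hv.symm) huv))

end PowerHomomorphisms

section ModularGroup

open scoped MatrixGroups
open Matrix

theorem PSL2Z_mk_eq_iff {A B : SL(2, ℤ)} : (A : PSL(2, ℤ)) = B ↔ B = A ∨ B = -A := by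
  rw [QuotientGroup.eq, Matrix.SpecialLinearGroup.mem_center_iff]
  constructor
  · rintro ⟨r, hr, h⟩
    have hr' : r = 1 ∨ r = -1 := by simpa using hr
    have hB : B = A * (A⁻¹ * B) := by group
    rcases hr' with rfl | rfl
    · left
      have : A⁻¹ * B = 1 := Subtype.ext (by rw [← h]; simp)
      rw [hB, this, mul_one]
    · right
      have : A⁻¹ * B = -1 := by
        refine Subtype.ext ?_
        rw [← h]
        ext i j
        fin_cases i <;> fin_cases j <;> simp
      rw [hB, this, mul_neg, mul_one]
  · rintro (rfl | rfl)
    · exact ⟨1, by simp, by simp⟩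
    · exact ⟨-1, by simp, by ext i j; fin_cases i <;> fin_cases j <;> simp⟩

/-- The image in `PSL(2, ℤ)` of the matrices whose first column has entries with product of the
given sign: negative for `0`, positive for `1`. -/
def columnSignSet (i : Fin 2) : Set PSL(2, ℤ) :=
  {g | ∃ A : SL(2, ℤ), (A : PSL(2, ℤ)) = g ∧ 0 < (![-1, 1] i : ℤ) * (A 0 0 * A 1 0)}

theorem columnSignSet_disjoint : Disjoint (columnSignSet 0) (columnSignSet 1) := by
  rw [Set.disjoint_left]
  rintro _ ⟨A, rfl, hA⟩ ⟨B, hBA, hB⟩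
  rcases PSL2Z_mk_eq_iff.1 hBA with rfl | rfl <;> simp at hA hB <;> linarith

/-- The matrix acting on the upper half plane by `z ↦ -1 / z`. -/
def orderTwoMatrix : SL(2, ℤ) := ⟨!![0, 1; -1, 0], by simp⟩

/-- A matrix of order three in `PSL(2, ℤ)`. -/
def orderThreeMatrix : SL(2, ℤ) := ⟨!![0, 1; -1, 1], by simp⟩

@[simp]
theorem coe_orderTwoMatrix : (orderTwoMatrix : Matrix (Fin 2) (Fin 2) ℤ) = !![0, 1; -1, 0] := rfl

@[simp]
theorem coe_orderThreeMatrix : (orderThreeMatrix : Matrix (Fin 2) (Fin 2) ℤ) = !![0, 1; -1, 1] :=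
  rfl

theorem orderTwo_pow : (orderTwoMatrix : PSL(2, ℤ)) ^ 2 = 1 := by
  rw [← QuotientGroup.mk_pow, ← QuotientGroup.mk_one, PSL2Z_mk_eq_iff]
  right; decide

theorem orderThree_pow : (orderThreeMatrix : PSL(2, ℤ)) ^ 3 = 1 := by
  rw [← QuotientGroup.mk_pow, ← QuotientGroup.mk_one, PSL2Z_mk_eq_iff]
  right; decide

/-- The homomorphism `ℤ/n → G` sending the generators of `ℤ/2` and `ℤ/3` to `s` and `u`. -/
def factorHom {G : Type*} [Group G] (s u : G) (hs : s ^ 2 = 1) (hu : u ^ 3 = 1) (i : Fin 2) :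
    Multiplicative (ZMod (i + 2)) →* G :=
  zmodPowersHom (i + 2) (![s, u] i) (by fin_cases i; exacts [hs, hu])

open scoped Pointwise in
/-- The subgroups of orders two and three generated by these matrices generate their free product:
ping-pong on the sign of the product of the entries of the first column. -/
theorem lift_factorHom_injective : Function.Injective (Monoid.CoprodI.lift
    (factorHom (orderTwoMatrix : PSL(2, ℤ)) orderThreeMatrix orderTwo_pow orderThree_pow)) := by
  refine Monoid.CoprodI.lift_injective_of_ping_pong _ (Or.inr ⟨1, ?_⟩) columnSignSet ?_ ?_ ?_
  · have : Nat.card (Multiplicative (ZMod 3)) = 3 := by simp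
    change 3 ≤ Cardinal.mk (Multiplicative (ZMod 3))
    rw [← Nat.cast_card, this, Nat.cast_ofNat]
  · intro i
    fin_cases i
    · exact ⟨_, ⟨!![1, 0; -1, 1], by simp⟩, rfl, by simp⟩
    · exact ⟨_, ⟨!![1, 0; 1, 1], by simp⟩, rfl, by simp⟩
  · intro i j hij
    fin_cases i <;> fin_cases j
    · exact absurd rfl hij
    · exact columnSignSet_disjoint
    · exact columnSignSet_disjoint.symm
    · exact absurd rfl hij
  · intro i j hij h hh
    rintro _ ⟨_, ⟨A, rfl, hA⟩, rfl⟩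
    beta_reduce
    have hval : h.toAdd.val ≠ 0 := by
      rw [Ne, ZMod.val_eq_zero]; exact hh
    have hlt : h.toAdd.val < i + 2 := ZMod.val_lt _
    rw [factorHom, zmodPowersHom_apply, smul_eq_mul]
    generalize h.toAdd.val = k at hval hlt
    fin_cases i <;> fin_cases j
    · exact absurd rfl hij
    · obtain rfl : k = 1 := by simp at hlt; omega
      refine ⟨orderTwoMatrix * A, by simp, ?_⟩
      simp [Matrix.mul_apply] at hA ⊢
      nlinarith
    · obtain rfl | rfl : k = 1 ∨ k = 2 := by simp at hlt; omega
      · refine ⟨orderThreeMatrix * A, by simp, ?_⟩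
        simp [Matrix.mul_apply] at hA ⊢
        nlinarith [sq_nonneg (A 1 0)]
      · refine ⟨orderThreeMatrix * (orderThreeMatrix * A), by simp [sq, mul_assoc], ?_⟩
        simp only [Matrix.SpecialLinearGroup.coe_mul, coe_orderThreeMatrix, Matrix.mul_apply,
          Fin.sum_univ_two]
        simp at hA ⊢
        nlinarith [sq_nonneg (A 0 0)]
    · exact absurd rfl hij

end ModularGroup

section Pell

open scoped MatrixGroups
open Matrix

/-- The fundamental solution `5 + 2√6` of the Pell equation `x² - 6y² = 1`. -/
def fundamentalSix : Pell.Solution₁ 6 := Pell.Solution₁.mk 5 2 (by norm_num)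

theorem isFundamental_fundamentalSix : Pell.IsFundamental fundamentalSix := by
  refine ⟨by simp [fundamentalSix], by simp [fundamentalSix], fun {b} hb => ?_⟩
  rw [fundamentalSix, Pell.Solution₁.x_mk]
  by_contra! hlt
  have hprop := b.prop
  generalize b.x = p at *
  generalize b.y = q at *
  interval_cases p <;> omega

/-- The solutions of the Pell equation `x² - 6y² = 1` as a group of matrices commuting with
`!![9, 4; 2, 1]`. -/
def pellMatrix : Pell.Solution₁ 6 →* SL(2, ℤ) where
  toFun s := ⟨!![s.x + 2 * s.y, 2 * s.y; s.y, s.x - 2 * s.y], by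
    rw [det_fin_two_of]; linear_combination s.prop⟩
  map_one' := by ext i j; fin_cases i <;> fin_cases j <;> simp
  map_mul' s t := by
    refine Subtype.ext ?_
    change !![(s * t).x + 2 * (s * t).y, 2 * (s * t).y; (s * t).y, (s * t).x - 2 * (s * t).y] =
      !![s.x + 2 * s.y, 2 * s.y; s.y, s.x - 2 * s.y] *
      !![t.x + 2 * t.y, 2 * t.y; t.y, t.x - 2 * t.y]
    rw [Pell.Solution₁.x_mul, Pell.Solution₁.y_mul, Matrix.mul_fin_two]
    ext i j
    fin_cases i <;> fin_cases j <;> simp <;> ring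

@[simp]
theorem coe_pellMatrix (s : Pell.Solution₁ 6) : (pellMatrix s : Matrix (Fin 2) (Fin 2) ℤ) =
    !![s.x + 2 * s.y, 2 * s.y; s.y, s.x - 2 * s.y] := rfl

/-- The class in `PSL(2, ℤ)` of a hyperbolic matrix that is primitive and not conjugate to its
inverse. -/
def hyperbolicElement : PSL(2, ℤ) := (pellMatrix fundamentalSix : SL(2, ℤ))

theorem not_isOfFinOrder_hyperbolicElement : ¬IsOfFinOrder hyperbolicElement := by
  rw [isOfFinOrder_iff_pow_eq_one]
  rintro ⟨n, hn, h⟩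
  rw [hyperbolicElement, ← QuotientGroup.mk_pow, ← map_pow, eq_comm, ← QuotientGroup.mk_one,
    PSL2Z_mk_eq_iff] at h
  obtain ⟨m, rfl⟩ := Nat.exists_eq_succ_of_ne_zero hn.ne'
  have hy : 0 < (fundamentalSix ^ (m + 1)).y :=
    Pell.Solution₁.y_pow_succ_pos (by simp [fundamentalSix]) (by simp [fundamentalSix]) m
  have : (pellMatrix (fundamentalSix ^ (m + 1))) 1 0 = 0 := by
    rcases h with h | h <;> rw [h] <;> simp
  rw [coe_pellMatrix] at this
  exact hy.ne' this

theorem pellMatrix_ne_neg_of_trace {s t : Pell.Solution₁ 6} {N : SL(2, ℤ)} (hs : 0 < s.x)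
    (ht : 0 < t.x) : N * pellMatrix s ≠ -(pellMatrix t * N) := by
  intro h
  have h' : N * pellMatrix s * N⁻¹ = -pellMatrix t := by rw [h]; simp [mul_assoc]
  have htr := congrArg (fun A : SL(2, ℤ) => (A : Matrix (Fin 2) (Fin 2) ℤ).trace) h'
  simp only [Matrix.SpecialLinearGroup.coe_mul] at htr
  rw [Matrix.trace_mul_comm, ← mul_assoc, ← Matrix.SpecialLinearGroup.coe_mul, inv_mul_cancel,
    Matrix.SpecialLinearGroup.coe_one, one_mul, Matrix.trace_fin_two, Matrix.trace_fin_two] at htr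
  simp at htr
  linarith

theorem mem_range_pellMatrix {s : Pell.Solution₁ 6} {N : SL(2, ℤ)} (hs : s.y ≠ 0)
    (h : N * pellMatrix s = pellMatrix s * N) : ∃ t, pellMatrix t = N := by
  have hdet := N.det_coe
  rw [det_fin_two] at hdet
  have h00 := congrArg (fun A : SL(2, ℤ) => A 0 0) h
  have h10 := congrArg (fun A : SL(2, ℤ) => A 1 0) h
  simp [Matrix.mul_apply] at h00 h10
  have e1 : N 0 1 = 2 * N 1 0 := mul_left_cancel₀ hs (by linear_combination h00)
  have e2 : N 1 1 = N 0 0 - 4 * N 1 0 := mul_left_cancel₀ hs (by linear_combination h10)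
  rw [e1, e2] at hdet
  refine ⟨Pell.Solution₁.mk (N 0 0 - 2 * N 1 0) (N 1 0) (by linear_combination hdet), ?_⟩
  ext i j
  fin_cases i <;> fin_cases j <;> simp [e1, e2]
  ring

theorem mul_pellMatrix_ne_inv {s : Pell.Solution₁ 6} {N : SL(2, ℤ)} (hs : s.y ≠ 0) :
    N * pellMatrix s ≠ pellMatrix s⁻¹ * N := by
  intro h
  have hdet := N.det_coe
  rw [det_fin_two] at hdet
  have h00 := congrArg (fun A : SL(2, ℤ) => A 0 0) h
  have h01 := congrArg (fun A : SL(2, ℤ) => A 0 1) h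
  simp [Matrix.mul_apply] at h00 h01
  have e1 : N 0 1 = -4 * N 0 0 - 2 * N 1 0 := mul_left_cancel₀ hs (by linear_combination h00)
  have e2 : N 1 1 = -N 0 0 :=
    mul_left_cancel₀ (mul_ne_zero two_ne_zero hs) (by linear_combination h01)
  rw [e1, e2] at hdet
  have key : ((N 0 0 - 2 * N 1 0 : ℤ) : ZMod 3) ^ 2 = -1 := by
    have : (N 0 0 - 2 * N 1 0) ^ 2 = -1 + 3 * (2 * N 1 0 ^ 2) := by linear_combination -hdet
    rw [← Int.cast_pow, this]
    push_cast
    rw [(by decide : (3 : ZMod 3) = 0)]; ring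
  generalize ((N 0 0 - 2 * N 1 0 : ℤ) : ZMod 3) = w at key
  revert w; decide

/-- An element conjugating a nontrivial power of the hyperbolic element to itself or to its inverse
is a power of the hyperbolic element. -/
theorem mem_zpowers_hyperbolicElement {k : PSL(2, ℤ)} {n : ℕ} (hn : 0 < n)
    (h : k * hyperbolicElement ^ n * k⁻¹ = hyperbolicElement ^ n ∨
      k * hyperbolicElement ^ n * k⁻¹ = (hyperbolicElement ^ n)⁻¹) :
    k ∈ Subgroup.zpowers hyperbolicElement := by
  obtain ⟨N, rfl⟩ := QuotientGroup.mk_surjective k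
  obtain ⟨m, rfl⟩ := Nat.exists_eq_succ_of_ne_zero hn.ne'
  set s := fundamentalSix ^ (m + 1)
  have hx : 0 < s.x := Pell.Solution₁.x_pow_pos (by simp [fundamentalSix]) _
  have hy : s.y ≠ 0 :=
    (Pell.Solution₁.y_pow_succ_pos (by simp [fundamentalSix]) (by simp [fundamentalSix]) m).ne'
  have hpow : hyperbolicElement ^ (m + 1) = (pellMatrix s : SL(2, ℤ)) := by
    rw [hyperbolicElement, ← QuotientGroup.mk_pow, ← map_pow]
  rw [Nat.succ_eq_add_one, hpow, mul_inv_eq_iff_eq_mul, mul_inv_eq_iff_eq_mul,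
    ← QuotientGroup.mk_inv, ← map_inv, ← QuotientGroup.mk_mul, ← QuotientGroup.mk_mul,
    ← QuotientGroup.mk_mul] at h
  have hcomm : N * pellMatrix s = pellMatrix s * N := by
    rcases h with h | h <;> rcases PSL2Z_mk_eq_iff.1 h.symm with h | h
    · exact h
    · exact absurd h (pellMatrix_ne_neg_of_trace hx hx)
    · exact absurd h (mul_pellMatrix_ne_inv hy)
    · exact absurd h (pellMatrix_ne_neg_of_trace hx (by rwa [Pell.Solution₁.x_inv]))
  obtain ⟨t, rfl⟩ := mem_range_pellMatrix hy hcomm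
  obtain ⟨j, hj⟩ := isFundamental_fundamentalSix.eq_zpow_or_neg_zpow t
  refine ⟨j, ?_⟩
  simp only [hyperbolicElement]
  rw [← QuotientGroup.mk_zpow, ← map_zpow, PSL2Z_mk_eq_iff]
  rcases hj with rfl | rfl
  · exact Or.inl rfl
  · right
    generalize fundamentalSix ^ j = r
    ext i j
    fin_cases i <;> fin_cases j <;> simp
    · ring
    · ring

end Pell

namespace SphereBraidRelations

variable {G : Type*} [Group G] {a b c : G}

theorem ratio_pow_four (h : SphereBraidRelations a b c) : (a * c⁻¹) ^ (2 * 2) = 1 := by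
  rw [pow_mul, sq, sq]
  nth_rw 1 [← h.ratio_sq_eq_inv]
  rw [inv_mul_cancel]

theorem conj_mul_conj (h : SphereBraidRelations a b c) :
    b * (a * c⁻¹) * b⁻¹ * (b * (a * c⁻¹) * b⁻¹) = (a * c⁻¹) ^ 2 := by
  calc b * (a * c⁻¹) * b⁻¹ * (b * (a * c⁻¹) * b⁻¹) = b * (a * c⁻¹ * (a * c⁻¹)) * b⁻¹ := by group
    _ = _ := by rw [← h.commute_ratio_sq_mid.eq, mul_inv_cancel_right, sq]

/-- The homomorphism `Q₈ → G` sending the generators to `ac⁻¹` and `b(ac⁻¹)b⁻¹`. -/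
def quaternionHom (h : SphereBraidRelations a b c) : QuaternionGroup 2 →* G :=
  QuaternionGroup.lift (a * c⁻¹) (b * (a * c⁻¹) * b⁻¹) h.ratio_pow_four h.conj_mul_conj
    h.ratio_mul_conj

theorem range_quaternionHom (h : SphereBraidRelations a b c) :
    h.quaternionHom.range = Subgroup.closure {a * c⁻¹, b * (a * c⁻¹) * b⁻¹} :=
  QuaternionGroup.range_lift

theorem ratio_mem_range (h : SphereBraidRelations a b c) : a * c⁻¹ ∈ h.quaternionHom.range := by
  rw [range_quaternionHom]; exact Subgroup.subset_closure (by simp)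

theorem conj_mem_range (h : SphereBraidRelations a b c) :
    b * (a * c⁻¹) * b⁻¹ ∈ h.quaternionHom.range := by
  rw [range_quaternionHom]; exact Subgroup.subset_closure (by simp)

theorem commute_left_ratio (h : SphereBraidRelations a b c) : Commute a (a * c⁻¹) :=
  (Commute.refl a).mul_right (Commute.inv_right h.comm)

theorem commute_right_ratio (h : SphereBraidRelations a b c) : Commute c (a * c⁻¹) :=
  (show Commute c a from h.comm.symm).mul_right (Commute.inv_right (Commute.refl c))

theorem mem_normalizer_range (h : SphereBraidRelations a b c) {g : G}
    (hx : g * (a * c⁻¹) * g⁻¹ ∈ h.quaternionHom.range)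
    (hy : g * (b * (a * c⁻¹) * b⁻¹) * g⁻¹ ∈ h.quaternionHom.range) :
    g ∈ Subgroup.normalizer (h.quaternionHom.range : Set G) := by
  have : Finite (h.quaternionHom.range : Set G) := Set.finite_range h.quaternionHom
  refine Subgroup.mem_normalizer_fintype fun n hn => ?_
  have hle : h.quaternionHom.range ≤ h.quaternionHom.range.comap (MulAut.conj g).toMonoidHom := by
    conv_lhs => rw [range_quaternionHom]
    rw [Subgroup.closure_le]
    rintro _ (rfl | rfl)
    exacts [hx, hy]
  exact hle hn

theorem normal_range (h : SphereBraidRelations a b c) (htop : Subgroup.closure {a, b, c} = ⊤) :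
    h.quaternionHom.range.Normal := by
  rw [← Subgroup.normalizer_eq_top_iff, eq_top_iff, ← htop, Subgroup.closure_le]
  have mx := h.ratio_mem_range
  have my := h.conj_mem_range
  rintro _ (rfl | rfl | rfl)
  · refine h.mem_normalizer_range ?_ ?_
    · rwa [h.commute_left_ratio.eq, mul_inv_cancel_right]
    · rw [h.conj_left]; exact mul_mem mx my
  · refine h.mem_normalizer_range my ?_
    rw [h.conj_mid]; exact inv_mem mx
  · refine h.mem_normalizer_range ?_ ?_
    · rwa [h.commute_right_ratio.eq, mul_inv_cancel_right]
    · rw [h.conj_right]; exact mul_mem my mx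

theorem commute_range (h : SphereBraidRelations a b c) (k : QuaternionGroup 2) :
    Commute (h.quaternionHom k) (a ^ 4 * (b ^ 2)⁻¹ * (a * c⁻¹ * (b * (a * c⁻¹) * b⁻¹))) := by
  have hy2 := h.conj_mul_conj
  have hxy := h.ratio_mul_conj
  have hx4 := h.ratio_pow_four
  have hax : Commute a (a * c⁻¹) := h.commute_left_ratio
  have hay := mul_inv_eq_iff_eq_mul.1 h.conj_left
  have hbx : b * (a * c⁻¹) = b * (a * c⁻¹) * b⁻¹ * b := by group
  have hby := mul_inv_eq_iff_eq_mul.1 h.conj_mid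
  suffices h.quaternionHom.range ≤ Subgroup.centralizer
      {a ^ 4 * (b ^ 2)⁻¹ * (a * c⁻¹ * (b * (a * c⁻¹) * b⁻¹))} from
    Subgroup.mem_centralizer_singleton_iff.1 (this ⟨k, rfl⟩)
  rw [range_quaternionHom, Subgroup.closure_le]
  generalize b * (a * c⁻¹) * b⁻¹ = y at *
  generalize a * c⁻¹ = x at *
  have hx4' : x * (x * (x * x)) = 1 := by rw [← hx4]; simp only [pow_succ, pow_zero]; group
  have hx3 : x * x * x = x⁻¹ := eq_inv_of_mul_eq_one_right (by simpa [mul_assoc] using hx4')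
  have ha4y : SemiconjBy (a ^ 4) y y := by
    have h1 : SemiconjBy a y (x * y) := hay
    have h2 : SemiconjBy a (x * y) (x * (x * y)) := SemiconjBy.mul_right hax h1
    have h3 : SemiconjBy a (x * (x * y)) (x * (x * (x * y))) := SemiconjBy.mul_right hax h2
    have h4 : SemiconjBy a (x * (x * (x * y))) y := by
      have := SemiconjBy.mul_right hax h3
      rwa [show x * (x * (x * (x * y))) = x * (x * (x * x)) * y by group, hx4', one_mul] at this
    simpa [pow_succ, mul_assoc] using h4.mul_left (h3.mul_left (h2.mul_left h1))
  have hb : SemiconjBy b x y := hbx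
  have hb' : SemiconjBy b y x⁻¹ := hby
  have hb2x : SemiconjBy (b ^ 2)⁻¹ x⁻¹ x :=
    (show SemiconjBy (b ^ 2) x x⁻¹ by rw [sq]; exact hb'.mul_left hb).inv_symm_left
  have hb2y : SemiconjBy (b ^ 2)⁻¹ y⁻¹ y :=
    (show SemiconjBy (b ^ 2) y y⁻¹ by rw [sq]; exact hb.inv_right.mul_left hb').inv_symm_left
  have hxyx : SemiconjBy (x * y) x x⁻¹ := by
    rw [SemiconjBy, inv_mul_cancel_left, hxy, inv_mul_cancel_right]
  have hxyy : SemiconjBy (x * y) y y⁻¹ := by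
    rw [SemiconjBy, mul_assoc, hy2, hxy, inv_mul_cancel_left, ← hx3, sq, mul_assoc]
  rintro _ (rfl | rfl) <;> rw [SetLike.mem_coe, Subgroup.mem_centralizer_singleton_iff]
  · exact (((SemiconjBy.mul_left (hax.pow_left 4) hb2x).mul_left hxyx).eq).symm
  · exact ((ha4y.mul_left hb2y).mul_left hxyy).eq.symm

end SphereBraidRelations

section SphereBraidGroup

open scoped MatrixGroups

theorem sphereBraidRelations_σ : SphereBraidRelations (σ 0) (σ 1) (σ 2) where
  comm := PresentedGroup.mk_eq_mk_of_mul_inv_mem (by simp [sphereBraidRels])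
  braid_left := PresentedGroup.mk_eq_mk_of_mul_inv_mem (by simp [sphereBraidRels])
  braid_right := PresentedGroup.mk_eq_mk_of_mul_inv_mem (by simp [sphereBraidRels])
  sphere := PresentedGroup.one_of_mem (by simp [sphereBraidRels])

theorem closure_σ : Subgroup.closure {σ 0, σ 1, σ 2} = ⊤ := by
  rw [eq_top_iff, ← PresentedGroup.closure_range_of, Subgroup.closure_le]
  rintro _ ⟨i, rfl⟩
  apply Subgroup.subset_closure
  fin_cases i <;> simp [σ]

/-- The homomorphism out of `B₄(S²)` determined by elements satisfying its defining relations. -/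
def SphereBraidRelations.lift {G : Type*} [Group G] {a b c : G} (h : SphereBraidRelations a b c) :
    B4S2 →* G :=
  PresentedGroup.toGroup (f := ![a, b, c]) <| by
    rintro _ (rfl | rfl | rfl | rfl)
    · rw [map_mul, map_inv, mul_inv_eq_one]; simpa using h.comm
    · rw [map_mul, map_inv, mul_inv_eq_one]; simpa using h.braid_left
    · rw [map_mul, map_inv, mul_inv_eq_one]; simpa using h.braid_right
    · simpa using h.sphere

@[simp]
theorem SphereBraidRelations.lift_σ {G : Type*} [Group G] {a b c : G}
    (h : SphereBraidRelations a b c) (i : Fin 3) : h.lift (σ i) = ![a, b, c] i :=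
  PresentedGroup.toGroup.of _

/-- Matrices over `ℤ/7` satisfying the defining relations of `B₄(S²)`. -/
def braidMatrix : Fin 3 → SL(2, ZMod 7) :=
  ![⟨!![0, 1; 6, 3], by decide⟩, ⟨!![0, 3; 2, 3], by decide⟩, ⟨!![3, 6; 1, 0], by decide⟩]

theorem sphereBraidRelations_braidMatrix :
    SphereBraidRelations (braidMatrix 0) (braidMatrix 1) (braidMatrix 2) := by
  constructor <;> decide

theorem quaternionHom_injective : Function.Injective sphereBraidRelations_σ.quaternionHom := by
  let X : SL(2, ZMod 7) := ⟨!![6, 3; 4, 1], by decide⟩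
  let Y : SL(2, ZMod 7) := ⟨!![2, 6; 5, 5], by decide⟩
  let f := sphereBraidRelations_braidMatrix.lift
  have hX : f (σ 0 * (σ 2)⁻¹) = X := by
    rw [map_mul, map_inv, mul_inv_eq_iff_eq_mul]
    simp only [f, SphereBraidRelations.lift_σ]
    decide
  have hY : f (σ 1 * (σ 0 * (σ 2)⁻¹) * (σ 1)⁻¹) = Y := by
    rw [map_mul, map_mul, hX, map_inv, mul_inv_eq_iff_eq_mul]
    simp only [f, SphereBraidRelations.lift_σ]
    decide
  rw [injective_iff_map_eq_one]
  rintro (i | i) hi <;> replace hi := congrArg f hi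
  · change f (zmodPowersHom _ _ (sphereBraidRelations_σ.ratio_pow_four) _) = f 1 at hi
    rw [zmodPowersHom_apply, map_pow, hX, map_one] at hi
    revert i
    decide
  · change f (_ * zmodPowersHom _ _ (sphereBraidRelations_σ.ratio_pow_four) _) = f 1 at hi
    rw [zmodPowersHom_apply, map_mul, map_pow, hX, hY, map_one] at hi
    revert i
    decide

/-- The lower triangular unipotent matrix braided with `ModularGroup.T`. -/
def lowerShear : SL(2, ℤ) := ⟨!![1, 0; -1, 1], by simp⟩

theorem sphereBraidRelations_PSL2Z : SphereBraidRelations (ModularGroup.T : PSL(2, ℤ)) lowerShear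
    ModularGroup.T where
  comm := rfl
  braid_left := congrArg QuotientGroup.mk
    (by decide : ModularGroup.T * lowerShear * ModularGroup.T =
      lowerShear * ModularGroup.T * lowerShear)
  braid_right := congrArg QuotientGroup.mk
    (by decide : lowerShear * ModularGroup.T * lowerShear =
      ModularGroup.T * lowerShear * ModularGroup.T)
  sphere := (PSL2Z_mk_eq_iff (A := ModularGroup.T * lowerShear * ModularGroup.T ^ 2 * lowerShear *
    ModularGroup.T) (B := 1)).2 (Or.inr (by decide))

/-- The homomorphism from `B₄(S²)` to the modular group. -/
def toPSL2Z : B4S2 →* PSL(2, ℤ) := sphereBraidRelations_PSL2Z.lift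

theorem toPSL2Z_ratio : toPSL2Z (σ 0 * (σ 2)⁻¹) = 1 := by
  rw [map_mul, map_inv, mul_inv_eq_one]; simp [toPSL2Z]

theorem range_quaternionHom_le_ker : sphereBraidRelations_σ.quaternionHom.range ≤ toPSL2Z.ker := by
  rw [SphereBraidRelations.range_quaternionHom, Subgroup.closure_le]
  rintro _ (rfl | rfl) <;> rw [SetLike.mem_coe, MonoidHom.mem_ker]
  · exact toPSL2Z_ratio
  · rw [map_mul, map_mul, toPSL2Z_ratio, mul_one, map_inv, mul_inv_cancel]

theorem comp_lift_factorHom {G H : Type*} [Group G] [Group H] (f : G →* H) {s u : G}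
    {s' u' : H} (hs : s ^ 2 = 1) (hu : u ^ 3 = 1) (hs' : s' ^ 2 = 1) (hu' : u' ^ 3 = 1)
    (hfs : f s = s') (hfu : f u = u') : f.comp (Monoid.CoprodI.lift (factorHom s u hs hu)) =
      Monoid.CoprodI.lift (factorHom s' u' hs' hu') := by
  subst hfs hfu
  refine Monoid.CoprodI.ext_hom _ _ fun i => MonoidHom.ext fun k => ?_
  rw [MonoidHom.comp_apply, MonoidHom.comp_apply, MonoidHom.comp_apply, Monoid.CoprodI.lift_of,
    Monoid.CoprodI.lift_of, factorHom, factorHom, zmodPowersHom_apply,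
    zmodPowersHom_apply, map_pow]
  fin_cases i <;> rfl

theorem generators_mem_range_lift_factorHom {G : Type*} [Group G] {s u : G} (hs : s ^ 2 = 1)
    (hu : u ^ 3 = 1) : s ∈ (Monoid.CoprodI.lift (factorHom s u hs hu)).range ∧
      u ∈ (Monoid.CoprodI.lift (factorHom s u hs hu)).range := by
  refine ⟨⟨Monoid.CoprodI.of (i := 0) (Multiplicative.ofAdd (1 : ZMod 2)), ?_⟩,
    ⟨Monoid.CoprodI.of (i := 1) (Multiplicative.ofAdd (1 : ZMod 3)), ?_⟩⟩
  · rw [Monoid.CoprodI.lift_of, factorHom, zmodPowersHom_apply]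
    exact pow_one s
  · rw [Monoid.CoprodI.lift_of, factorHom, zmodPowersHom_apply]
    exact pow_one u

/-- The kernel of the homomorphism to the modular group is the quaternion subgroup: the modular
group is a free product `ℤ/2 * ℤ/3`, so the homomorphism splits modulo the quaternion subgroup. -/
theorem ker_toPSL2Z_le : toPSL2Z.ker ≤ sphereBraidRelations_σ.quaternionHom.range := by
  have hrel := sphereBraidRelations_σ
  set Q := sphereBraidRelations_σ.quaternionHom.range
  have : Q.Normal := sphereBraidRelations_σ.normal_range closure_σ
  have hx2 : σ 0 * (σ 2)⁻¹ * (σ 0 * (σ 2)⁻¹) ∈ Q :=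
    mul_mem hrel.ratio_mem_range hrel.ratio_mem_range
  have hs : ((σ 0 * σ 1 * σ 0 : B4S2) : B4S2 ⧸ Q) ^ 2 = 1 := by
    rw [← QuotientGroup.mk_pow, QuotientGroup.eq_one_iff, sq, ← hrel.ratio_sq]
    exact hx2
  have hu : ((σ 0 * σ 1 : B4S2) : B4S2 ⧸ Q) ^ 3 = 1 := by
    rw [← hs, ← QuotientGroup.mk_pow, ← QuotientGroup.mk_pow, sq]
    congr 1
    nth_rw 2 [hrel.braid_left]
    simp only [pow_succ, pow_zero, one_mul, mul_assoc]
  set f : B4S2 ⧸ Q →* PSL(2, ℤ) := QuotientGroup.lift Q toPSL2Z range_quaternionHom_le_ker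
  have hfs : f ((σ 0 * σ 1 * σ 0 : B4S2) : B4S2 ⧸ Q) = orderTwoMatrix := by
    change toPSL2Z (σ 0 * σ 1 * σ 0) = _
    rw [map_mul, map_mul]
    simp only [toPSL2Z, SphereBraidRelations.lift_σ]
    exact congrArg QuotientGroup.mk
      (by decide : ModularGroup.T * lowerShear * ModularGroup.T = orderTwoMatrix)
  have hfu : f ((σ 0 * σ 1 : B4S2) : B4S2 ⧸ Q) = orderThreeMatrix := by
    change toPSL2Z (σ 0 * σ 1) = _
    rw [map_mul]
    simp only [toPSL2Z, SphereBraidRelations.lift_σ]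
    exact congrArg QuotientGroup.mk (by decide : ModularGroup.T * lowerShear = orderThreeMatrix)
  have hinj : Function.Injective (f.comp (Monoid.CoprodI.lift (factorHom _ _ hs hu))) := by
    rw [comp_lift_factorHom f hs hu orderTwo_pow orderThree_pow hfs hfu]
    exact lift_factorHom_injective
  have hsurj : (Monoid.CoprodI.lift (factorHom _ _ hs hu)).range = ⊤ := by
    obtain ⟨ms, mu⟩ := generators_mem_range_lift_factorHom hs hu
    generalize (Monoid.CoprodI.lift (factorHom _ _ hs hu)).range = R at ms mu
    have m0 : ((σ 0 : B4S2) : B4S2 ⧸ Q) ∈ R := by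
      have := mul_mem (inv_mem mu) ms
      rwa [← QuotientGroup.mk_inv, ← QuotientGroup.mk_mul, inv_mul_cancel_left] at this
    have m1 : ((σ 1 : B4S2) : B4S2 ⧸ Q) ∈ R := by
      have := mul_mem (inv_mem m0) mu
      rwa [← QuotientGroup.mk_inv, ← QuotientGroup.mk_mul, inv_mul_cancel_left] at this
    have m2 : ((σ 2 : B4S2) : B4S2 ⧸ Q) ∈ R := by
      rw [← (QuotientGroup.eq (s := Q)).2 (?_ : (σ 0)⁻¹ * σ 2 ∈ Q)]
      · exact m0
      · rw [(Commute.inv_left hrel.comm : Commute (σ 0)⁻¹ (σ 2)).eq]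
        rw [← inv_mem_iff, mul_inv_rev, inv_inv]
        exact hrel.ratio_mem_range
    have hle : ⊤ ≤ R.comap (QuotientGroup.mk' Q) := by
      rw [← closure_σ, Subgroup.closure_le]
      rintro _ (rfl | rfl | rfl)
      exacts [m0, m1, m2]
    rw [eq_top_iff]
    intro g _
    obtain ⟨g, rfl⟩ := QuotientGroup.mk_surjective g
    exact hle (Subgroup.mem_top g)
  have hf : Function.Injective f :=
    Function.Injective.of_comp_right hinj (MonoidHom.range_eq_top.1 hsurj)
  intro g hg
  rw [← QuotientGroup.eq_one_iff]
  exact hf (hg.trans (map_one f).symm)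

/-- A braid of infinite order commuting with the quaternion subgroup. -/
def hyperbolicBraid : B4S2 :=
  σ 0 ^ 4 * (σ 1 ^ 2)⁻¹ * (σ 0 * (σ 2)⁻¹ * (σ 1 * (σ 0 * (σ 2)⁻¹) * (σ 1)⁻¹))

theorem toPSL2Z_hyperbolicBraid : toPSL2Z hyperbolicBraid = hyperbolicElement := by
  have hx := toPSL2Z_ratio
  rw [hyperbolicBraid, map_mul, map_mul _ (σ 0 * _), hx, map_mul _ (_ * _) (σ 1)⁻¹,
    map_mul _ (σ 1) (_ * _), hx, map_inv, map_mul, map_inv, mul_one, mul_inv_cancel, mul_one,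
    mul_one, map_pow, map_pow, mul_inv_eq_iff_eq_mul]
  simp only [toPSL2Z, SphereBraidRelations.lift_σ]
  refine congrArg QuotientGroup.mk
    (?_ : ModularGroup.T ^ 4 = pellMatrix fundamentalSix * lowerShear ^ 2)
  decide

end SphereBraidGroup

/-- `B₄(S²)` contains a subgroup isomorphic to `Q₈ × ℤ` that is maximal
as a virtually cyclic subgroup. -/
theorem maximal_Q8_prod_Z_subgroup :
    ∃ M : Subgroup B4S2,
      Nonempty (M ≃* (QuaternionGroup 2 × Multiplicative ℤ)) ∧
      IsVirtuallyCyclic M ∧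
      ∀ K : Subgroup B4S2, IsVirtuallyCyclic K → M ≤ K → K = M := by
  have hinj : Function.Injective (zpowersHom B4S2 hyperbolicBraid) := by
    refine fun m n hmn => Multiplicative.toAdd.injective ?_
    refine injective_zpow_iff_not_isOfFinOrder.2 not_isOfFinOrder_hyperbolicElement ?_
    simpa [toPSL2Z_hyperbolicBraid] using congrArg toPSL2Z hmn
  let f := sphereBraidRelations_σ.quaternionHom.noncommCoprod (zpowersHom B4S2 hyperbolicBraid)
    fun k n => (sphereBraidRelations_σ.commute_range k).zpow_right _
  have hf_apply (p : QuaternionGroup 2) (m : ℤ) : f (p, Multiplicative.ofAdd m) =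
      sphereBraidRelations_σ.quaternionHom p * hyperbolicBraid ^ m := rfl
  have hf : Function.Injective f := by
    refine (MonoidHom.noncommCoprod_injective _ _ _).2 ⟨quaternionHom_injective, hinj, ?_⟩
    rw [Subgroup.disjoint_def]
    rintro _ hg ⟨n, rfl⟩
    have h := range_quaternionHom_le_ker hg
    rw [MonoidHom.mem_ker, zpowersHom_apply, map_zpow, toPSL2Z_hyperbolicBraid] at h
    rw [zpowersHom_apply, injective_zpow_iff_not_isOfFinOrder.2 not_isOfFinOrder_hyperbolicElement
      (h.trans (zpow_zero _).symm : _ = hyperbolicElement ^ (0 : ℤ)), zpow_zero]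
  let e := (MonoidHom.ofInjective hf).symm
  have hord : ¬IsOfFinOrder hyperbolicBraid := fun h =>
    not_isOfFinOrder_hyperbolicElement (toPSL2Z_hyperbolicBraid ▸ toPSL2Z.isOfFinOrder h)
  refine ⟨f.range, ⟨e⟩, isVirtuallyCyclic_of_mulEquiv_prod e, fun K hK hle => ?_⟩
  refine le_antisymm (fun k hk => ?_) hle
  have hmem : hyperbolicBraid ∈ f.range :=
    ⟨(1, Multiplicative.ofAdd 1), by rw [hf_apply, map_one, one_mul, zpow_one]⟩
  obtain ⟨n, hn, hconj⟩ := hK.exists_conj_pow (g := ⟨hyperbolicBraid, hle hmem⟩)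
    (by rwa [← Submonoid.isOfFinOrder_coe]) ⟨k, hk⟩
  have hconj' := hconj.imp (congrArg (toPSL2Z.comp K.subtype)) (congrArg (toPSL2Z.comp K.subtype))
  simp only [map_mul, map_pow, map_inv, MonoidHom.comp_apply, Subgroup.subtype_apply,
    toPSL2Z_hyperbolicBraid] at hconj'
  obtain ⟨m, hm⟩ := mem_zpowers_hyperbolicElement hn hconj'
  have hker : k * (hyperbolicBraid ^ m)⁻¹ ∈ toPSL2Z.ker := by
    rw [MonoidHom.mem_ker, map_mul, map_inv, map_zpow, toPSL2Z_hyperbolicBraid, mul_inv_eq_one]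
    exact hm.symm
  obtain ⟨p, hp⟩ := ker_toPSL2Z_le hker
  exact ⟨(p, Multiplicative.ofAdd m), by rw [hf_apply, hp, inv_mul_cancel_right]⟩
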